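/- arXiv:1003.5151 — 2 statements merged into one kernel-verified Lean document; each statement's English description precedes it below -/
import Mathlib

section
/- Let k be any field and n ≥ 1 an integer. Then the Weyl algebra A_n(k), realized as the k-subalgebra of End_k(k[x_1,…,x_n]) generated by the multiplication operators by x_1,…,x_n together with all divided power operators ∂_i^[r] for 1 ≤ i ≤ n and r ≥ 1, is a coherent ring (both left and right coherent). -/
/-- The divided power operator `∂_i^[r]` on `k[x_1,…,x_n]`, the `k`-linear map determined on
monomials by `∂_i^[r](x^m) = C(m_i, r) • x^(m - r·ε_i)` (zero when `m_i < r`). -/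
noncomputable def dividedPower (k : Type*) [Field k] (n : ℕ) (i : Fin n) (r : ℕ) :
    Module.End k (MvPolynomial (Fin n) k) :=
  (MvPolynomial.basisMonomials (Fin n) k).constr k fun m =>
    ((m i).choose r : k) • MvPolynomial.monomial (m - Finsupp.single i r) 1

/-- The Weyl algebra `A_n(k)`, the `k`-subalgebra of `End_k(k[x_1,…,x_n])` generated by the
multiplication operators by `x_1,…,x_n` together with all divided powers `∂_i^[r]`, `r ≥ 1`. -/
noncomputable def weylAlgebra (k : Type*) [Field k] (n : ℕ) :
    Subalgebra k (Module.End k (MvPolynomial (Fin n) k)) :=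
  Algebra.adjoin k
    ((Set.range fun i : Fin n => (LinearMap.mulLeft k (MvPolynomial.X i) :
        Module.End k (MvPolynomial (Fin n) k))) ∪
      {f | ∃ (i : Fin n) (r : ℕ), 1 ≤ r ∧ f = dividedPower k n i r})

/-- A ring is left coherent if every finitely generated left ideal is finitely presented. -/
def IsLeftCoherent (R : Type*) [Ring R] : Prop :=
  ∀ I : Ideal R, I.FG → Module.FinitePresentation R I

/-- A ring is right coherent if every finitely generated right ideal is finitely presented. -/
def IsRightCoherent (R : Type*) [Ring R] : Prop :=
  ∀ I : Ideal Rᵐᵒᵖ, I.FG → Module.FinitePresentation Rᵐᵒᵖ I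

/-- The subalgebra `A_r = k[x_1^{p^r},…,x_n^{p^r}]` of `A = k[x_1,…,x_n]`. -/
noncomputable def subAr (k : Type*) [Field k] (n p r : ℕ) :
    Subalgebra k (MvPolynomial (Fin n) k) :=
  Algebra.adjoin k (Set.range fun i : Fin n => MvPolynomial.X i ^ p ^ r)

/-- The ring `D_r = End_{A_r}(A)` of `A_r`-module endomorphisms of `A`, viewed as the subring of
`End_k(A)` of endomorphisms commuting with multiplication by elements of `A_r`. -/
noncomputable def endAr (k : Type*) [Field k] (n p r : ℕ) :
    Subring (Module.End k (MvPolynomial (Fin n) k)) :=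
  Subring.centralizer
    ((fun b => (LinearMap.mulLeft k b : Module.End k (MvPolynomial (Fin n) k))) ''
      (subAr k n p r : Set (MvPolynomial (Fin n) k)))

section OreExtension

variable {S R : Type*} [Ring S] [Ring R] (f : S →+* R) (y : R)

/-- The additive group of sums `∑_{i < m} f(s_i) y^i`. -/
def polyFiltration : ℕ → AddSubgroup R
  | 0 => ⊥
  | m + 1 => polyFiltration m ⊔ ((AddMonoidHom.mulRight (y ^ m)).comp f.toAddMonoidHom).range

lemma mem_polyFiltration_succ {m : ℕ} {r : R} :
    r ∈ polyFiltration f y (m + 1) ↔ ∃ s, ∃ g ∈ polyFiltration f y m, f s * y ^ m + g = r := by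
  simp only [polyFiltration, AddSubgroup.mem_sup, AddMonoidHom.mem_range]
  constructor
  · rintro ⟨g, hg, _, ⟨s, rfl⟩, rfl⟩
    exact ⟨s, g, hg, add_comm _ _⟩
  · rintro ⟨s, g, hg, rfl⟩
    exact ⟨g, hg, _, ⟨s, rfl⟩, add_comm _ _⟩

lemma polyFiltration_mono : Monotone (polyFiltration f y) :=
  monotone_nat_of_le_succ fun _ => le_sup_left

lemma map_mul_mem_polyFiltration (s : S) {m : ℕ} {r : R} (hr : r ∈ polyFiltration f y m) :
    f s * r ∈ polyFiltration f y m := by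
  induction m generalizing r with
  | zero =>
    have : r = 0 := hr
    simp [this]
  | succ m ih =>
    obtain ⟨s', g, hg, rfl⟩ := (mem_polyFiltration_succ f y).1 hr
    exact (mem_polyFiltration_succ f y).2
      ⟨s * s', f s * g, ih hg, by rw [map_mul, mul_add, mul_assoc]⟩

variable {f y}

lemma mul_mem_polyFiltration (hy : ∀ s, ∃ s', y * f s - f s * y = f s') {m : ℕ} {r : R}
    (hr : r ∈ polyFiltration f y m) : y * r ∈ polyFiltration f y (m + 1) := by
  induction m generalizing r with
  | zero =>
    have : r = 0 := hr
    simp [this]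
  | succ m ih =>
    obtain ⟨s, g, hg, rfl⟩ := (mem_polyFiltration_succ f y).1 hr
    obtain ⟨s', hs'⟩ := hy s
    refine (mem_polyFiltration_succ f y).2 ⟨s, f s' * y ^ m + y * g, add_mem ?_ (ih hg), ?_⟩
    · exact (mem_polyFiltration_succ f y).2 ⟨s', 0, zero_mem _, add_zero _⟩
    · rw [← hs', pow_succ']
      noncomm_ring

lemma exists_mem_polyFiltration (hy : ∀ s, ∃ s', y * f s - f s * y = f s')
    (hgen : ∀ T : Subring R, (∀ s, f s ∈ T) → y ∈ T → T = ⊤) (r : R) :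
    ∃ m, r ∈ polyFiltration f y m := by
  have hdir : Directed (· ≤ ·) (polyFiltration f y) := (polyFiltration_mono f y).directed_le
  let F : AddSubgroup R := ⨆ m, polyFiltration f y m
  have hF : ∀ {z}, z ∈ F ↔ ∃ m, z ∈ polyFiltration f y m := AddSubgroup.mem_iSup_of_directed hdir
  let T : Subring R :=
    { carrier := {r | ∀ z ∈ F, r * z ∈ F}
      mul_mem' := fun {a b} ha hb z hz => by rw [mul_assoc]; exact ha _ (hb _ hz)
      one_mem' := fun z hz => by rwa [one_mul]
      add_mem' := fun {a b} ha hb z hz => by rw [add_mul]; exact add_mem (ha _ hz) (hb _ hz)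
      zero_mem' := fun z _ => by rw [zero_mul]; exact zero_mem _
      neg_mem' := fun {a} ha z hz => by rw [neg_mul]; exact neg_mem (ha _ hz) }
  have hT : T = ⊤ := by
    apply hgen
    · intro s z hz
      obtain ⟨m, hm⟩ := hF.1 hz
      exact hF.2 ⟨m, map_mul_mem_polyFiltration f y s hm⟩
    · intro z hz
      obtain ⟨m, hm⟩ := hF.1 hz
      exact hF.2 ⟨m + 1, mul_mem_polyFiltration hy hm⟩
  have h1 : (1 : R) ∈ F :=
    hF.2 ⟨1, (mem_polyFiltration_succ f y).2 ⟨1, 0, zero_mem _, by simp⟩⟩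
  have hr : r ∈ T := hT ▸ Subring.mem_top r
  simpa using hF.1 (hr 1 h1)

variable (f y) in
/-- The left ideal of coefficients of `y ^ m` in elements `f(s) y^m + (lower terms)` of `I`. -/
def leadingIdeal (I : Ideal R) (m : ℕ) : Ideal S where
  carrier := {s | ∃ g ∈ polyFiltration f y m, f s * y ^ m + g ∈ I}
  add_mem' := by
    rintro a b ⟨g, hg, ha⟩ ⟨g', hg', hb⟩
    refine ⟨g + g', add_mem hg hg', ?_⟩
    convert add_mem ha hb using 1
    rw [map_add, add_mul]
    abel
  zero_mem' := ⟨0, zero_mem _, by simp⟩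
  smul_mem' := by
    rintro c a ⟨g, hg, ha⟩
    refine ⟨f c * g, map_mul_mem_polyFiltration f y c hg, ?_⟩
    convert I.mul_mem_left (f c) ha using 1
    rw [smul_eq_mul, map_mul, mul_add, mul_assoc]

lemma leadingIdeal_mono (hy : ∀ s, ∃ s', y * f s - f s * y = f s') {I J : Ideal R} (hIJ : I ≤ J)
    {m m' : ℕ} (hm : m ≤ m') : leadingIdeal f y I m ≤ leadingIdeal f y J m' := by
  induction hm with
  | refl => exact fun s ⟨g, hg, hs⟩ => ⟨g, hg, hIJ hs⟩
  | @step m' _ ih =>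
    intro s hs
    obtain ⟨g, hg, hs⟩ := ih hs
    obtain ⟨s', hs'⟩ := hy s
    refine ⟨f s' * y ^ m' + y * g, add_mem ?_ (mul_mem_polyFiltration hy hg), ?_⟩
    · exact (mem_polyFiltration_succ f y).2 ⟨s', 0, zero_mem _, add_zero _⟩
    · convert J.mul_mem_left y hs using 1
      rw [← hs', Nat.succ_eq_add_one, pow_succ']
      noncomm_ring

lemma eq_of_leadingIdeal_eq (hy : ∀ s, ∃ s', y * f s - f s * y = f s')
    (hgen : ∀ T : Subring R, (∀ s, f s ∈ T) → y ∈ T → T = ⊤) {I J : Ideal R} (hIJ : I ≤ J)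
    (h : ∀ m, leadingIdeal f y J m ≤ leadingIdeal f y I m) : I = J := by
  refine le_antisymm hIJ fun r hr => ?_
  obtain ⟨m, hm⟩ := exists_mem_polyFiltration hy hgen r
  induction m generalizing r with
  | zero =>
    have : r = 0 := hm
    simp [this]
  | succ m ih =>
    obtain ⟨s, g, hg, rfl⟩ := (mem_polyFiltration_succ f y).1 hm
    obtain ⟨g', hg', hs⟩ := h m ⟨g, hg, hr⟩
    have key : f s * y ^ m + g = (f s * y ^ m + g') + (g - g') := by abel
    rw [key]
    refine I.add_mem hs (ih _ ?_ (sub_mem hg hg'))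
    have := J.sub_mem hr (hIJ hs)
    rwa [add_sub_add_left_eq_sub] at this

/-- A Hilbert basis theorem: if `R` is generated by the image of a left Noetherian ring `S` and an
element `y` with `[y, S] ⊆ S`, then `R` is left Noetherian. -/
theorem isNoetherianRing_of_commutator_mem [IsNoetherianRing S]
    (hy : ∀ s, ∃ s', y * f s - f s * y = f s')
    (hgen : ∀ T : Subring R, (∀ s, f s ∈ T) → y ∈ T → T = ⊤) : IsNoetherianRing R := by
  have noeth := monotone_stabilizes_iff_noetherian.2 ‹IsNoetherianRing S›
  refine monotone_stabilizes_iff_noetherian.1 fun I => ?_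
  obtain ⟨N, hN⟩ := noeth ⟨fun m => leadingIdeal f y (I m) m,
    fun a b hab => leadingIdeal_mono hy (I.monotone hab) hab⟩
  have hcol : ∀ m, ∃ K, ∀ j, K ≤ j → leadingIdeal f y (I K) m = leadingIdeal f y (I j) m :=
    fun m => noeth ⟨fun j => leadingIdeal f y (I j) m,
      fun a b hab => leadingIdeal_mono hy (I.monotone hab) le_rfl⟩
  choose K hK using hcol
  refine ⟨N + ∑ m ∈ Finset.range N, K m, fun j hj =>
    eq_of_leadingIdeal_eq hy hgen (I.monotone hj) fun m => ?_⟩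
  rcases lt_or_ge m N with hm | hm
  · have hKm : K m ≤ N + ∑ m ∈ Finset.range N, K m :=
      (Finset.single_le_sum (fun _ _ => Nat.zero_le _) (Finset.mem_range.2 hm)).trans
        (Nat.le_add_left _ _)
    rw [← hK m _ hKm, ← hK m _ (hKm.trans hj)]
  · calc leadingIdeal f y (I j) m
        ≤ leadingIdeal f y (I (max m j)) (max m j) :=
          leadingIdeal_mono hy (I.monotone (le_max_right _ _)) (le_max_left _ _)
      _ = leadingIdeal f y (I N) N := (hN _ (hm.trans (le_max_left _ _))).symm
      _ ≤ _ := leadingIdeal_mono hy (I.monotone (Nat.le_add_right _ _)) hm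

theorem isNoetherianRing_op_of_commutator_mem [IsNoetherianRing Sᵐᵒᵖ]
    (hy : ∀ s, ∃ s', y * f s - f s * y = f s')
    (hgen : ∀ T : Subring R, (∀ s, f s ∈ T) → y ∈ T → T = ⊤) : IsNoetherianRing Rᵐᵒᵖ := by
  refine isNoetherianRing_of_commutator_mem (f := RingHom.op f) (y := MulOpposite.op y) ?_ ?_
  · intro s
    obtain ⟨s', hs'⟩ := hy s.unop
    refine ⟨MulOpposite.op (-s'), MulOpposite.unop_injective ?_⟩
    simp [← hs']
  · intro T hf hT
    have := hgen T.unop (fun s => hf (MulOpposite.op s)) hT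
    exact Subring.unop_injective (this.trans Subring.unop_top.symm)

end OreExtension

section Coherence

lemma isNoetherianRing_of_finite_left {S T : Type*} [Ring S] [Ring T] [IsNoetherianRing S]
    (f : S →+* T) {m : ℕ} (e : Fin m → T) (c : Fin m → T → S)
    (h : ∀ r, ∑ b, f (c b r) * e b = r) : IsNoetherianRing T := by
  let _ : Module S T := Module.compHom T f
  have : IsScalarTower S T T := ⟨fun s a b => mul_assoc (f s) a b⟩
  have : Module.Finite S T := by
    refine Module.Finite.of_surjective (Fintype.linearCombination S e) fun r => ⟨fun b => c b r, ?_⟩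
    rw [Fintype.linearCombination_apply]
    exact h r
  exact isNoetherian_of_tower S inferInstance

/-- The ring `S'` looks like a ring of matrices of size `M + 1` over its subring `S`, the centralizer
in `S'` of an element `X` whose power of exponent `M + 1` is central in `S'`. -/
structure IsMatrixStep {R : Type*} [Ring R] (S S' : Subring R) (M : ℕ) (X t : R) : Prop where
  X_mem : X ∈ S'
  t_mem : t ∈ S'
  mem_iff : ∀ g, g ∈ S ↔ g ∈ S' ∧ X * g = g * X
  pow_comm : ∀ g ∈ S', X ^ (M + 1) * g = g * X ^ (M + 1)
  sum_eq_one : ∑ j ∈ Finset.range (M + 1), X ^ j * t * X ^ (M - j) = 1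
  t_mul_t : ∀ j ≤ M, t * X ^ j * t = if j = M then t else 0

namespace IsMatrixStep

variable {R : Type*} [Ring R] {S S' : Subring R} {M : ℕ} {X t : R}

lemma op (h : IsMatrixStep S S' M X t) :
    IsMatrixStep S.op S'.op M (MulOpposite.op X) (MulOpposite.op t) where
  X_mem := h.X_mem
  t_mem := h.t_mem
  mem_iff g := by
    have := h.mem_iff g.unop
    rw [Subring.mem_op, Subring.mem_op, this, ← MulOpposite.unop_inj]
    exact and_congr Iff.rfl eq_comm
  pow_comm g hg := MulOpposite.unop_injective (h.pow_comm _ hg).symm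
  sum_eq_one := by
    apply MulOpposite.unop_injective
    rw [← Finset.sum_range_reflect, Finset.unop_sum, MulOpposite.unop_one, ← h.sum_eq_one]
    refine Finset.sum_congr rfl fun j hj => ?_
    have hj' : j ≤ M := Nat.lt_succ_iff.1 (Finset.mem_range.1 hj)
    simp only [MulOpposite.unop_mul, MulOpposite.unop_pow, MulOpposite.unop_op, mul_assoc]
    congr 2
    omega
  t_mul_t j hj := by
    apply MulOpposite.unop_injective
    have := h.t_mul_t j hj
    split_ifs at this ⊢ with hjM <;>
      simpa [mul_assoc] using this

variable (M X) in
/-- The averaging operator `g ↦ ∑_j X^j g X^{M-j}`. -/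
def average (g : R) : R := ∑ j ∈ Finset.range (M + 1), X ^ j * g * X ^ (M - j)

lemma average_mem (h : IsMatrixStep S S' M X t) {g : R} (hg : g ∈ S') : average M X g ∈ S := by
  refine (h.mem_iff _).2 ⟨sum_mem fun j _ => mul_mem (mul_mem (pow_mem h.X_mem _) hg)
    (pow_mem h.X_mem _), ?_⟩
  rw [average, Finset.mul_sum, Finset.sum_mul, Finset.sum_range_succ, Finset.sum_range_succ',
    add_comm]
  have h0 : X ^ 0 * g * X ^ (M - 0) * X = X * (X ^ M * g * X ^ (M - M)) := by
    have := h.pow_comm g hg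
    rw [Nat.sub_self, pow_zero, one_mul, Nat.sub_zero, mul_assoc, ← pow_succ, ← this, pow_succ']
    noncomm_ring
  rw [add_comm, h0]
  congr 1
  refine Finset.sum_congr rfl fun j hj => ?_
  have hj' : M - j = M - (j + 1) + 1 := by have := Finset.mem_range.1 hj; omega
  rw [hj', pow_succ, pow_succ']
  noncomm_ring

lemma average_mul (h : IsMatrixStep S S' M X t) (g : R) {s : R} (hs : s ∈ S) :
    average M X (g * s) = average M X g * s := by
  have hc : Commute X s := ((h.mem_iff s).1 hs).2
  rw [average, average, Finset.sum_mul]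
  refine Finset.sum_congr rfl fun j _ => ?_
  simp only [mul_assoc, (hc.pow_left _).eq]

lemma average_mul_t (h : IsMatrixStep S S' M X t) (g : R) :
    average M X (g * t) * t = g * t := by
  have : ∀ j ∈ Finset.range (M + 1), X ^ j * (g * t) * X ^ (M - j) * t =
      if j = 0 then g * t else 0 := by
    intro j hj
    have hj' : j ≤ M := Nat.lt_succ_iff.1 (Finset.mem_range.1 hj)
    have h2 := h.t_mul_t (M - j) (Nat.sub_le _ _)
    calc _ = X ^ j * g * (t * X ^ (M - j) * t) := by noncomm_ring
      _ = _ := by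
        rw [h2]
        by_cases hj0 : j = 0
        · simp [hj0]
        · rw [if_neg (by omega), if_neg hj0, mul_zero]
  rw [average, Finset.sum_mul, Finset.sum_congr rfl this]
  simp

lemma t_mul_average (h : IsMatrixStep S S' M X t) (g : R) :
    t * average M X (t * g) = t * g := by
  have : ∀ j ∈ Finset.range (M + 1), t * (X ^ j * (t * g) * X ^ (M - j)) =
      if j = M then t * g else 0 := by
    intro j hj
    have hj' : j ≤ M := Nat.lt_succ_iff.1 (Finset.mem_range.1 hj)
    calc _ = t * X ^ j * t * (g * X ^ (M - j)) := by noncomm_ring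
      _ = _ := by
        rw [h.t_mul_t j hj']
        by_cases hjM : j = M
        · simp [hjM]
        · simp [hjM]
  rw [average, Finset.mul_sum, Finset.sum_congr rfl this]
  simp

lemma eq_sum_mul_average (h : IsMatrixStep S S' M X t) (g : R) :
    g = ∑ b ∈ Finset.range (M + 1), X ^ b * t * average M X (t * (X ^ (M - b) * g)) := by
  conv_lhs => rw [← one_mul g, ← h.sum_eq_one, Finset.sum_mul]
  refine Finset.sum_congr rfl fun b _ => ?_
  rw [mul_assoc (X ^ b) t (average _ _ _), h.t_mul_average]
  noncomm_ring

lemma eq_sum_average_mul (h : IsMatrixStep S S' M X t) (g : R) :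
    g = ∑ b ∈ Finset.range (M + 1), average M X (g * X ^ b * t) * (t * X ^ (M - b)) := by
  conv_lhs => rw [← mul_one g, ← h.sum_eq_one, Finset.mul_sum]
  refine Finset.sum_congr rfl fun b _ => ?_
  rw [← mul_assoc (average _ _ _), h.average_mul_t]
  noncomm_ring

lemma le (h : IsMatrixStep S S' M X t) : S ≤ S' := fun g hg => ((h.mem_iff g).1 hg).1

lemma isNoetherianRing (h : IsMatrixStep S S' M X t) [IsNoetherianRing S] :
    IsNoetherianRing S' := by
  refine isNoetherianRing_of_finite_left (Subring.inclusion h.le) (m := M + 1)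
    (fun b => ⟨t * X ^ (M - (b : ℕ)), mul_mem h.t_mem (pow_mem h.X_mem _)⟩)
    (fun b r => ⟨average M X (r * X ^ (b : ℕ) * t),
      h.average_mem (mul_mem (mul_mem r.2 (pow_mem h.X_mem _)) h.t_mem)⟩) fun r => ?_
  apply Subtype.ext
  rw [AddSubmonoidClass.coe_finsetSum]
  exact (Fin.sum_univ_eq_sum_range
    (fun b => average M X (r * X ^ b * t) * (t * X ^ (M - b))) (M + 1)).trans
      (h.eq_sum_average_mul (r : R)).symm

end IsMatrixStep

variable {R : Type*} [Ring R]

/-- The elementwise form of flatness of `R` as a right `S`-module for a directed union `R` of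
matrix steps starting from `S`. -/
lemma mem_span_relations (B : ℕ → Subring R)
    (hB : ∀ N, ∃ M X t, IsMatrixStep (B N) (B (N + 1)) M X t)
    {m : ℕ} (N : ℕ) (a : Fin m → R) (ha : ∀ j, a j ∈ B N) (K : ℕ) (c : Fin m → R)
    (hc : ∀ j, c j ∈ B (N + K)) (h : ∑ j, c j * a j = 0) :
    c ∈ Submodule.span R {s : Fin m → R | (∀ j, s j ∈ B N) ∧ ∑ j, s j * a j = 0} := by
  induction K generalizing c with
  | zero => exact Submodule.subset_span ⟨hc, h⟩
  | succ K ih =>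
    obtain ⟨M, X, t, hs⟩ := hB (N + K)
    have hmono : Monotone B := monotone_nat_of_le_succ fun N => by
      obtain ⟨M, X, t, hs⟩ := hB N
      exact hs.le
    have hexp : c = ∑ b ∈ Finset.range (M + 1),
        (X ^ b * t) • fun j => IsMatrixStep.average M X (t * (X ^ (M - b) * c j)) := by
      funext j
      rw [Finset.sum_apply]
      exact hs.eq_sum_mul_average (c j)
    rw [hexp]
    refine sum_mem fun b _ => Submodule.smul_mem _ _ (ih _ (fun j => hs.average_mem
      (mul_mem hs.t_mem (mul_mem (pow_mem hs.X_mem _) (hc j)))) ?_)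
    calc _ = ∑ j, IsMatrixStep.average M X (t * X ^ (M - b) * (c j * a j)) := by
          refine Finset.sum_congr rfl fun j _ => ?_
          rw [← hs.average_mul _ (hmono (Nat.le_add_right N K) (ha j))]
          congr 1
          noncomm_ring
      _ = IsMatrixStep.average M X (t * X ^ (M - b) * ∑ j, c j * a j) := by
          simp only [IsMatrixStep.average, Finset.mul_sum, Finset.sum_mul]
          rw [Finset.sum_comm]
      _ = 0 := by simp [h, IsMatrixStep.average]

theorem isLeftCoherent_of_matrixSteps (B : ℕ → Subring R)
    (hB : ∀ N, ∃ M X t, IsMatrixStep (B N) (B (N + 1)) M X t) (h0 : IsNoetherianRing (B 0))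
    (hcover : ∀ r, ∃ N, r ∈ B N) : IsLeftCoherent R := by
  have hmono : Monotone B := monotone_nat_of_le_succ fun N => by
    obtain ⟨M, X, t, hs⟩ := hB N
    exact hs.le
  have hnoeth : ∀ N, IsNoetherianRing (B N) := fun N => by
    induction N with
    | zero => exact h0
    | succ N ih =>
      obtain ⟨M, X, t, hs⟩ := hB N
      exact hs.isNoetherianRing
  have hcover' : ∀ {m : ℕ} (a : Fin m → R), ∃ N, ∀ j, a j ∈ B N := fun a => by
    choose N hN using fun j => hcover (a j)
    exact ⟨Finset.univ.sup N, fun j => hmono (Finset.le_sup (Finset.mem_univ j)) (hN j)⟩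
  intro I hI
  obtain ⟨m, a, rfl⟩ := Submodule.fg_iff_exists_fin_generating_family.1 hI
  obtain ⟨N, hN⟩ := hcover' a
  let l : (Fin m → R) →ₗ[R] R := Fintype.linearCombination R a
  have hl : LinearMap.range l = Submodule.span R (Set.range a) := Fintype.range_linearCombination R a
  rw [← hl]
  refine Module.finitePresentation_of_free_of_surjective l.rangeRestrict
    l.surjective_rangeRestrict ?_
  rw [LinearMap.ker_rangeRestrict]
  have := hnoeth N
  let l₀ : (Fin m → B N) →ₗ[B N] B N := Fintype.linearCombination (B N) fun j => ⟨a j, hN j⟩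
  obtain ⟨G, hG⟩ := IsNoetherian.noetherian (LinearMap.ker l₀)
  let incl : (Fin m → B N) → Fin m → R := fun s j => s j
  classical
  refine ⟨G.image incl, le_antisymm (Submodule.span_le.2 ?_) fun c hc => ?_⟩
  · rw [Finset.coe_image]
    rintro _ ⟨s, hs, rfl⟩
    have hs' : l₀ s = 0 := by
      rw [← LinearMap.mem_ker, ← hG]
      exact Submodule.subset_span hs
    have := congrArg (Subtype.val) hs'
    simpa [l₀, l, incl, Fintype.linearCombination_apply] using this
  · obtain ⟨K, hK⟩ := hcover' c
    have hsum : ∑ j, c j * a j = 0 := by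
      simpa [l, Fintype.linearCombination_apply] using hc
    refine Submodule.span_le.2 ?_ (mem_span_relations B hB N a hN K c
      (fun j => hmono (Nat.le_add_left K N) (hK j)) hsum)
    rintro s ⟨hs, hrel⟩
    obtain ⟨s, rfl⟩ : ∃ s' : Fin m → B N, incl s' = s := ⟨fun j => ⟨s j, hs j⟩, rfl⟩
    have hmem : s ∈ Submodule.span (B N) (G : Set _) := by
      rw [hG, LinearMap.mem_ker]
      apply Subtype.ext
      simpa [l₀, incl, Fintype.linearCombination_apply] using hrel
    clear hs hrel
    induction hmem using Submodule.span_induction with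
    | mem x hx => exact Submodule.subset_span (by simpa using ⟨x, hx, rfl⟩)
    | zero => exact zero_mem _
    | add x y _ _ hx hy => exact add_mem hx hy
    | smul r x _ hx => exact Submodule.smul_mem _ (r : R) hx

/-- A directed union of matrix steps starting from a commutative Noetherian ring is coherent. -/
theorem coherent_of_matrixSteps (B : ℕ → Subring R)
    (hB : ∀ N, ∃ M X t, IsMatrixStep (B N) (B (N + 1)) M X t) {Z : Type*} [CommRing Z]
    [IsNoetherianRing Z] (f : Z →+* R) (hf : f.range = B 0) (hcover : ∀ r, ∃ N, r ∈ B N) :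
    IsLeftCoherent R ∧ IsRightCoherent R := by
  refine ⟨isLeftCoherent_of_matrixSteps B hB (hf ▸ isNoetherianRing_range f) hcover,
    isLeftCoherent_of_matrixSteps (fun N => (B N).op) (fun N => ?_) ?_ fun r => hcover r.unop⟩
  · obtain ⟨M, X, t, h⟩ := hB N
    exact ⟨M, _, _, h.op⟩
  · have h0 : (f.toOpposite fun a b => (Commute.all a b).map f).range = (B 0).op := by
      rw [← hf]
      ext r
      exact exists_congr fun a => MulOpposite.unop_inj.symm
    exact h0 ▸ isNoetherianRing_range _

theorem coherent_of_isNoetherianRing [IsNoetherianRing R] [IsNoetherianRing Rᵐᵒᵖ] :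
    IsLeftCoherent R ∧ IsRightCoherent R :=
  ⟨fun _ _ => Module.finitePresentation_of_finite _ _,
    fun _ _ => Module.finitePresentation_of_finite _ _⟩

end Coherence

section Binomial

lemma choose_pow_mul_modEq {p : ℕ} [Fact p.Prime] (v m b : ℕ) :
    m.choose (p ^ v * b) ≡ (m / p ^ v).choose b [MOD p] := by
  induction v generalizing m with
  | zero => simp [Nat.ModEq.refl]
  | succ v ih =>
    have hp : 0 < p := (Fact.out : p.Prime).pos
    have h1 := Choose.choose_modEq_choose_mod_mul_choose_div_nat (n := m) (k := p ^ (v + 1) * b)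
      (p := p)
    have e : p ^ (v + 1) * b = p * (p ^ v * b) := by ring
    rw [e, Nat.mul_mod_right, Nat.choose_zero_right, one_mul, Nat.mul_div_cancel_left _ hp] at h1
    rw [e]
    refine h1.trans ((ih _).trans ?_)
    rw [Nat.div_div_eq_div_mul, pow_succ']

lemma choose_add_pow_modEq {p : ℕ} [Fact p.Prime] {s r : ℕ} (hr : r < p ^ s) (m : ℕ) :
    (m + p ^ s).choose r ≡ m.choose r [MOD p] := by
  induction s generalizing r m with
  | zero =>
    obtain rfl : r = 0 := by simpa using hr
    simp [Nat.ModEq.refl]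
  | succ s ih =>
    have hp : 0 < p := (Fact.out : p.Prime).pos
    have h1 := Choose.choose_modEq_choose_mod_mul_choose_div_nat (n := m + p ^ (s + 1)) (k := r)
      (p := p)
    have h2 := Choose.choose_modEq_choose_mod_mul_choose_div_nat (n := m) (k := r) (p := p)
    rw [pow_succ', Nat.add_mul_mod_self_left, Nat.add_mul_div_left _ _ hp] at h1
    rw [pow_succ']
    have hr' : r / p < p ^ s := Nat.div_lt_of_lt_mul (by rwa [← pow_succ'])
    exact h1.trans (((ih hr' _).mul_left _).trans h2.symm)

lemma cast_choose_pow_mul_pred (k : Type*) [Ring k] {p : ℕ} [Fact p.Prime] [CharP k p] (v m : ℕ) :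
    (m.choose (p ^ v * (p - 1)) : k) = if m / p ^ v % p = p - 1 then 1 else 0 := by
  have hp : 0 < p := (Fact.out : p.Prime).pos
  have h1 := Choose.choose_modEq_choose_mod_mul_choose_div_nat (n := m / p ^ v) (k := p - 1)
    (p := p)
  have hlt : p - 1 < p := Nat.sub_lt hp one_pos
  rw [Nat.mod_eq_of_lt hlt, Nat.div_eq_of_lt hlt, Nat.choose_zero_right, mul_one] at h1
  rw [(CharP.natCast_eq_natCast k p).2 ((choose_pow_mul_modEq v m (p - 1)).trans h1)]
  split_ifs with h
  · rw [h, Nat.choose_self, Nat.cast_one]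
  · have := Nat.mod_lt (m / p ^ v) hp
    rw [Nat.choose_eq_zero_of_lt (by omega), Nat.cast_zero]

lemma sum_cast_choose_pow_mul_pred (k : Type*) [Ring k] {p : ℕ} [Fact p.Prime] [CharP k p]
    (v m : ℕ) :
    ∑ j ∈ Finset.range (p - 1 + 1),
      ((m + p ^ v * (p - 1 - j)).choose (p ^ v * (p - 1)) : k) = 1 := by
  have hp : 0 < p := (Fact.out : p.Prime).pos
  have hlt := Nat.mod_lt (m / p ^ v) hp
  rw [Finset.sum_eq_single (m / p ^ v % p)]
  · rw [cast_choose_pow_mul_pred, Nat.add_mul_div_left _ _ (pow_pos hp v), if_pos]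
    rw [Nat.add_mod, Nat.mod_eq_of_lt (a := p - 1 - _) (by omega), Nat.mod_eq_of_lt] <;> omega
  · intro j hj hne
    have hj := Finset.mem_range.1 hj
    rw [cast_choose_pow_mul_pred, Nat.add_mul_div_left _ _ (pow_pos hp v), if_neg]
    intro h
    rw [Nat.add_mod, Nat.mod_eq_of_lt (a := p - 1 - j) (by omega)] at h
    rcases lt_or_ge (m / p ^ v % p + (p - 1 - j)) p with hl | hl
    · rw [Nat.mod_eq_of_lt hl] at h
      omega
    · rw [Nat.mod_eq_sub_mod hl, Nat.mod_eq_of_lt (by omega)] at h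
      omega
  · intro h
    exact absurd (Finset.mem_range.2 (by omega)) h

lemma cast_choose_mul_cast_choose (k : Type*) [Ring k] {p : ℕ} [Fact p.Prime] [CharP k p]
    (v m : ℕ) {j : ℕ} (hj : j ≤ p - 1) :
    (m.choose (p ^ v * (p - 1)) : k) *
        ((p ^ v * j + (m - p ^ v * (p - 1))).choose (p ^ v * (p - 1)) : k) =
      if j = p - 1 then (m.choose (p ^ v * (p - 1)) : k) else 0 := by
  have hp : 0 < p := (Fact.out : p.Prime).pos
  rw [cast_choose_pow_mul_pred, cast_choose_pow_mul_pred]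
  by_cases h : m / p ^ v % p = p - 1
  · have h2 : (p ^ v * j + (m - p ^ v * (p - 1))) / p ^ v % p = j := by
      rw [Nat.mul_add_div (pow_pos hp v), Nat.sub_mul_div]
      have hd := Nat.div_add_mod (m / p ^ v) p
      rw [h] at hd
      rw [← hd, Nat.add_sub_cancel, Nat.add_mul_mod_self_left, Nat.mod_eq_of_lt (by omega)]
    simp [h, h2]
  · simp [h]

end Binomial

lemma mem_subring_of_eq_adjoin {k A : Type*} [CommRing k] [Ring A] [Algebra k A] {s : Set A}
    {B : Subalgebra k A} (hB : B = Algebra.adjoin k s) (T : Subring B)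
    (hk : ∀ c, algebraMap k B c ∈ T) (hs : ∀ x ∈ s, ∀ hx : x ∈ B, ⟨x, hx⟩ ∈ T) (g : B) :
    g ∈ T := by
  subst hB
  obtain ⟨g, hg⟩ := g
  induction hg using Algebra.adjoin_induction with
  | mem x hx => exact hs x hx _
  | algebraMap c => exact hk c
  | add a b _ _ ha hb => exact add_mem ha hb
  | mul a b _ _ ha hb => exact mul_mem ha hb

/-- Adjoining an element `y` with `[y, B] ⊆ B` preserves left and right Noetherianity. -/
lemma isNoetherianRing_of_eq_adjoin {k A : Type*} [CommRing k] [Ring A] [Algebra k A] {s : Set A}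
    {B B' : Subalgebra k A} (hB' : B' = Algebra.adjoin k s) (hle : B ≤ B') {y : A} (hy : y ∈ B')
    (hs : ∀ x ∈ s, x ∈ B ∨ x = y) (hcomm : ∀ g ∈ B, y * g - g * y ∈ B)
    (hB : IsNoetherianRing B ∧ IsNoetherianRing Bᵐᵒᵖ) :
    IsNoetherianRing B' ∧ IsNoetherianRing B'ᵐᵒᵖ := by
  obtain ⟨h1, h2⟩ := hB
  let f : B →+* B' := (Subalgebra.inclusion hle).toRingHom
  have hcomm' : ∀ g, ∃ g', (⟨y, hy⟩ : B') * f g - f g * ⟨y, hy⟩ = f g' := fun g =>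
    ⟨⟨_, hcomm g g.2⟩, rfl⟩
  have hgen : ∀ T : Subring B', (∀ g, f g ∈ T) → (⟨y, hy⟩ : B') ∈ T → T = ⊤ := by
    intro T hf hyT
    refine eq_top_iff.2 fun g _ => mem_subring_of_eq_adjoin hB' T
      (fun c => hf (algebraMap k B c)) (fun x hx hxB' => ?_) g
    rcases hs x hx with hxB | rfl
    · exact hf ⟨x, hxB⟩
    · exact hyT
  exact ⟨isNoetherianRing_of_commutator_mem hcomm' hgen,
    isNoetherianRing_op_of_commutator_mem hcomm' hgen⟩

section Weyl

open MvPolynomial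

variable (k : Type*) [Field k] (n : ℕ)

lemma dividedPower_monomial (i : Fin n) (r : ℕ) (m : Fin n →₀ ℕ) :
    dividedPower k n i r (monomial m 1) =
      ((m i).choose r : k) • monomial (m - Finsupp.single i r) 1 := by
  have := (basisMonomials (Fin n) k).constr_basis k
    (fun m => ((m i).choose r : k) • monomial (m - Finsupp.single i r) (1 : k)) m
  rwa [coe_basisMonomials] at this

lemma lmul_X_pow_monomial (i : Fin n) (a : ℕ) (m : Fin n →₀ ℕ) :
    Algebra.lmul k (MvPolynomial (Fin n) k) (X i ^ a) (monomial m 1) =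
      monomial (Finsupp.single i a + m) 1 := by
  rw [X_pow_eq_monomial]
  simp [monomial_mul]

variable {k n}

lemma end_ext {f g : Module.End k (MvPolynomial (Fin n) k)}
    (h : ∀ m, f (monomial m 1) = g (monomial m 1)) : f = g :=
  (basisMonomials (Fin n) k).ext fun m => by simpa using h m

lemma dividedPower_comm_of_choose {i j : Fin n} {r a : ℕ}
    (h : ∀ m : Fin n →₀ ℕ, (((Finsupp.single j a + m) i).choose r : k) = ((m i).choose r : k)) :
    Algebra.lmul k (MvPolynomial (Fin n) k) (X j ^ a) * dividedPower k n i r =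
      dividedPower k n i r * Algebra.lmul k (MvPolynomial (Fin n) k) (X j ^ a) := by
  refine end_ext fun m => ?_
  rw [Module.End.mul_apply, Module.End.mul_apply, dividedPower_monomial, map_smul,
    lmul_X_pow_monomial, lmul_X_pow_monomial, dividedPower_monomial, h]
  rcases lt_or_ge (m i) r with hr | hr
  · simp [Nat.choose_eq_zero_of_lt hr]
  · rw [add_tsub_assoc_of_le]
    simpa using hr

lemma dividedPower_comm_of_ne {i j : Fin n} (hij : j ≠ i) (r a : ℕ) :
    Algebra.lmul k (MvPolynomial (Fin n) k) (X j ^ a) * dividedPower k n i r =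
      dividedPower k n i r * Algebra.lmul k (MvPolynomial (Fin n) k) (X j ^ a) :=
  dividedPower_comm_of_choose fun m => by simp [hij]

lemma dividedPower_comm_pow {p : ℕ} [Fact p.Prime] [CharP k p] (i j : Fin n) {r s : ℕ}
    (hr : r < p ^ s) :
    Algebra.lmul k (MvPolynomial (Fin n) k) (X j ^ p ^ s) * dividedPower k n i r =
      dividedPower k n i r * Algebra.lmul k (MvPolynomial (Fin n) k) (X j ^ p ^ s) := by
  by_cases hij : j = i
  · subst hij
    refine dividedPower_comm_of_choose fun m => ?_
    rw [CharP.natCast_eq_natCast k p, Finsupp.add_apply, Finsupp.single_eq_same, add_comm]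
    exact choose_add_pow_modEq hr _
  · exact dividedPower_comm_of_ne hij _ _

lemma sum_pow_mul_dividedPower_mul_pow {p : ℕ} [Fact p.Prime] [CharP k p] (i : Fin n) (v : ℕ) :
    ∑ j ∈ Finset.range (p - 1 + 1), Algebra.lmul k (MvPolynomial (Fin n) k) (X i ^ p ^ v) ^ j *
      dividedPower k n i (p ^ v * (p - 1)) *
      Algebra.lmul k (MvPolynomial (Fin n) k) (X i ^ p ^ v) ^ (p - 1 - j) = 1 := by
  refine end_ext fun m => ?_
  have key : ∀ j ∈ Finset.range (p - 1 + 1),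
      (Algebra.lmul k (MvPolynomial (Fin n) k) (X i ^ p ^ v) ^ j *
        dividedPower k n i (p ^ v * (p - 1)) *
        Algebra.lmul k (MvPolynomial (Fin n) k) (X i ^ p ^ v) ^ (p - 1 - j)) (monomial m 1) =
      ((m i + p ^ v * (p - 1 - j)).choose (p ^ v * (p - 1)) : k) • monomial m (1 : k) := by
    intro j hj
    have hj : j ≤ p - 1 := Nat.lt_succ_iff.1 (Finset.mem_range.1 hj)
    rw [← map_pow, ← map_pow, ← pow_mul, ← pow_mul, Module.End.mul_apply, Module.End.mul_apply,
      lmul_X_pow_monomial, dividedPower_monomial, map_smul, lmul_X_pow_monomial,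
      Finsupp.add_apply, Finsupp.single_eq_same, add_comm (p ^ v * (p - 1 - j))]
    rcases lt_or_ge (m i + p ^ v * (p - 1 - j)) (p ^ v * (p - 1)) with hr | hr
    · simp [Nat.choose_eq_zero_of_lt hr]
    · have hadd : p ^ v * (p - 1 - j) + p ^ v * j = p ^ v * (p - 1) := by
        rw [← mul_add, Nat.sub_add_cancel hj]
      have hm : Finsupp.single i (p ^ v * j) + (Finsupp.single i (p ^ v * (p - 1 - j)) + m -
          Finsupp.single i (p ^ v * (p - 1))) = m := by
        ext l
        by_cases hl : l = i
        · subst hl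
          simp only [Finsupp.add_apply, Finsupp.tsub_apply, Finsupp.single_eq_same]
          omega
        · simp [hl]
      rw [hm]
  rw [LinearMap.sum_apply, Finset.sum_congr rfl key, ← Finset.sum_smul,
    sum_cast_choose_pow_mul_pred, one_smul, Module.End.one_apply]

lemma dividedPower_mul_pow_mul_dividedPower {p : ℕ} [Fact p.Prime] [CharP k p] (i : Fin n)
    (v : ℕ) {j : ℕ} (hj : j ≤ p - 1) :
    dividedPower k n i (p ^ v * (p - 1)) *
      Algebra.lmul k (MvPolynomial (Fin n) k) (X i ^ p ^ v) ^ j *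
      dividedPower k n i (p ^ v * (p - 1)) =
      if j = p - 1 then dividedPower k n i (p ^ v * (p - 1)) else 0 := by
  refine end_ext fun m => ?_
  rw [← map_pow, ← pow_mul, Module.End.mul_apply, Module.End.mul_apply, dividedPower_monomial,
    map_smul, lmul_X_pow_monomial, map_smul, dividedPower_monomial, smul_smul, Finsupp.add_apply,
    Finsupp.tsub_apply, Finsupp.single_eq_same, Finsupp.single_eq_same,
    cast_choose_mul_cast_choose k v _ hj]
  split_ifs with h
  · rw [h, add_tsub_cancel_left, dividedPower_monomial]
  · simp

lemma lmul_mem_weylAlgebra (a : MvPolynomial (Fin n) k) :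
    Algebra.lmul k (MvPolynomial (Fin n) k) a ∈ weylAlgebra k n := by
  induction a using MvPolynomial.induction_on with
  | C c =>
    rw [← algebraMap_eq, AlgHom.commutes]
    exact algebraMap_mem _ _
  | add a b ha hb => rw [map_add]; exact add_mem ha hb
  | mul_X a i ha =>
    rw [map_mul]
    exact mul_mem ha (Algebra.subset_adjoin (Or.inl ⟨i, rfl⟩))

lemma dividedPower_zero (i : Fin n) : dividedPower k n i 0 = 1 :=
  end_ext fun m => by simp [dividedPower_monomial]

lemma dividedPower_mem_weylAlgebra (i : Fin n) (r : ℕ) :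
    dividedPower k n i r ∈ weylAlgebra k n := by
  rcases Nat.eq_zero_or_pos r with rfl | hr
  · rw [dividedPower_zero]
    exact one_mem _
  · exact Algebra.subset_adjoin (Or.inr ⟨i, r, hr, rfl⟩)

lemma lmul_of_forall_comm {f : Module.End k (MvPolynomial (Fin n) k)}
    (h : ∀ i, Algebra.lmul k (MvPolynomial (Fin n) k) (X i) * f =
      f * Algebra.lmul k (MvPolynomial (Fin n) k) (X i)) :
    Algebra.lmul k (MvPolynomial (Fin n) k) (f 1) = f := by
  refine LinearMap.ext fun a => ?_
  induction a using MvPolynomial.induction_on with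
  | C c =>
    rw [← mul_one (C c), ← smul_eq_C_mul, map_smul, map_smul]
    simp
  | add a b ha hb => rw [map_add, map_add, ha, hb]
  | mul_X a i ha =>
    have := LinearMap.congr_fun (h i) a
    simp only [Module.End.mul_apply, Algebra.coe_lmul_eq_mul, LinearMap.mul_apply'] at this ha ⊢
    rw [mul_comm a, ← this, ← ha]
    ring

/-- Multiplication operators, as elements of the Weyl algebra. -/
noncomputable def weylMul : MvPolynomial (Fin n) k →+* weylAlgebra k n :=
  ((Algebra.lmul k (MvPolynomial (Fin n) k)).codRestrict (weylAlgebra k n)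
    lmul_mem_weylAlgebra).toRingHom

lemma coe_weylMul (a : MvPolynomial (Fin n) k) :
    (weylMul a : Module.End k (MvPolynomial (Fin n) k)) = Algebra.lmul k _ a := rfl

/-- The elements of the Weyl algebra that commute with `x_i ^ (p ^ v_i)` for all `i`. -/
noncomputable def weylLevel (k : Type*) [Field k] {n : ℕ} (p : ℕ) (v : Fin n → ℕ) :
    Subring (weylAlgebra k n) :=
  Subring.centralizer (Set.range fun i => weylMul (X i ^ p ^ v i))

lemma mem_weylLevel {p : ℕ} {v : Fin n → ℕ} {g : weylAlgebra k n} :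
    g ∈ weylLevel k p v ↔ ∀ i, weylMul (X i ^ p ^ v i) * g = g * weylMul (X i ^ p ^ v i) := by
  simp only [weylLevel, Subring.mem_centralizer_iff, Set.forall_mem_range]

lemma weylMul_mem_weylLevel (p : ℕ) (v : Fin n → ℕ) (a : MvPolynomial (Fin n) k) :
    weylMul a ∈ weylLevel k p v :=
  mem_weylLevel.2 fun i => by rw [← map_mul, ← map_mul, mul_comm]

lemma weylLevel_zero (p : ℕ) :
    (weylMul : MvPolynomial (Fin n) k →+* weylAlgebra k n).range = weylLevel k p 0 := by
  refine le_antisymm (by rintro _ ⟨a, rfl⟩; exact weylMul_mem_weylLevel p 0 a) fun g hg => ?_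
  refine ⟨(g : Module.End k (MvPolynomial (Fin n) k)) 1, Subtype.ext (lmul_of_forall_comm ?_)⟩
  intro i
  have := congrArg Subtype.val (mem_weylLevel.1 hg i)
  simpa [coe_weylMul] using this

lemma isMatrixStep_weylLevel {p : ℕ} [Fact p.Prime] [CharP k p] {v w : Fin n → ℕ} (i : Fin n)
    (hw : ∀ j, w j = v j + if j = i then 1 else 0) :
    IsMatrixStep (weylLevel k p v) (weylLevel k p w) (p - 1) (weylMul (X i ^ p ^ v i))
      ⟨dividedPower k n i (p ^ v i * (p - 1)), dividedPower_mem_weylAlgebra _ _⟩ := by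
  have hp : 0 < p := (Fact.out : p.Prime).pos
  have hwi : w i = v i + 1 := by simp [hw]
  have hpow : (weylMul (X i ^ p ^ v i) : weylAlgebra k n) ^ (p - 1 + 1) =
      weylMul (X i ^ p ^ w i) := by
    rw [← map_pow, ← pow_mul, hwi, Nat.sub_add_cancel hp, ← pow_succ]
  refine ⟨weylMul_mem_weylLevel _ _ _, ?_, fun g => ?_, fun g hg => ?_, ?_, fun j hj => ?_⟩
  · refine mem_weylLevel.2 fun j => Subtype.ext ?_
    by_cases hij : j = i
    · subst hij
      refine dividedPower_comm_pow j j ?_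
      rw [hwi, pow_succ]
      exact Nat.mul_lt_mul_of_pos_left (Nat.sub_lt hp one_pos) (pow_pos hp _)
    · exact dividedPower_comm_of_ne hij _ _
  · rw [mem_weylLevel, mem_weylLevel]
    constructor
    · refine fun h => ⟨fun j => ?_, h i⟩
      by_cases hij : j = i
      · subst hij
        rw [← hpow]
        exact Commute.pow_left (h j) _
      · have := h j
        rwa [hw, if_neg hij, add_zero]
    · rintro ⟨h, hi⟩ j
      by_cases hij : j = i
      · rwa [hij]
      · have := h j
        rwa [hw, if_neg hij, add_zero] at this
  · rw [hpow]
    exact mem_weylLevel.1 hg i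
  · apply Subtype.ext
    rw [AddSubmonoidClass.coe_finsetSum]
    exact sum_pow_mul_dividedPower_mul_pow i (v i)
  · apply Subtype.ext
    rw [apply_ite (Subtype.val)]
    exact dividedPower_mul_pow_mul_dividedPower i (v i) hj

lemma weylLevel_mono {p : ℕ} : Monotone (weylLevel k p : (Fin n → ℕ) → _) := by
  intro v w hvw g hg
  refine mem_weylLevel.2 fun i => ?_
  obtain ⟨c, hc⟩ := Nat.exists_eq_add_of_le (hvw i)
  rw [hc, pow_add, pow_mul, map_pow]
  exact Commute.pow_left (mem_weylLevel.1 hg i) _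

lemma exists_mem_weylLevel {p : ℕ} [Fact p.Prime] [CharP k p] (g : weylAlgebra k n) :
    ∃ s : ℕ, g ∈ weylLevel k p fun _ => s := by
  have hmono : Monotone fun s : ℕ => weylLevel k p fun _ : Fin n => s :=
    fun a b hab => weylLevel_mono fun _ => hab
  have hmem : ∀ {x}, x ∈ ⨆ s : ℕ, weylLevel k p (fun _ : Fin n => s) ↔
      ∃ s : ℕ, x ∈ weylLevel k p fun _ : Fin n => s :=
    Subring.mem_iSup_of_directed hmono.directed_le
  refine hmem.1 (mem_subring_of_eq_adjoin rfl _ (fun c => hmem.2 ⟨0, ?_⟩)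
    (fun x hx _ => hmem.2 ?_) g)
  · exact mem_weylLevel.2 fun j => (Algebra.commutes c (weylMul (X j ^ p ^ 0))).symm
  · rcases hx with ⟨i, rfl⟩ | ⟨i, r, -, rfl⟩
    · have hX : (⟨LinearMap.mulLeft k (X i), Algebra.subset_adjoin (Or.inl ⟨i, rfl⟩)⟩ :
          weylAlgebra k n) = weylMul (X i) := Subtype.ext rfl
      exact ⟨0, hX ▸ weylMul_mem_weylLevel p _ (X i)⟩
    · have hr : r < p ^ r := Nat.lt_pow_self (Fact.out : p.Prime).one_lt
      refine ⟨r, mem_weylLevel.2 fun j => Subtype.ext ?_⟩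
      exact dividedPower_comm_pow i j hr

theorem weylAlgebra_coherent_of_charP (p : ℕ) [Fact p.Prime] [CharP k p] (hn : 1 ≤ n) :
    IsLeftCoherent (weylAlgebra k n) ∧ IsRightCoherent (weylAlgebra k n) := by
  let v : ℕ → Fin n → ℕ := fun N i => (N + (n - 1 - i)) / n
  refine coherent_of_matrixSteps (fun N => weylLevel k p (v N)) (fun N => ?_) weylMul ?_ fun g => ?_
  · refine ⟨_, _, _, isMatrixStep_weylLevel ⟨N % n, Nat.mod_lt _ hn⟩ fun j => ?_⟩
    simp only [v]
    rw [add_right_comm, Nat.succ_div]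
    congr 1
    have hj := j.2
    have e : N + (n - 1 - j) + 1 = N + (n - j) := by omega
    have hd : n ∣ N + (n - (j : ℕ)) ↔ j = ⟨N % n, Nat.mod_lt _ hn⟩ := by
      rw [Fin.ext_iff, ← (Nat.mod_eq_of_lt hj : (j : ℕ) % n = j)]
      rw [Nat.mod_eq_of_lt hj]
      constructor
      · rintro ⟨c, hc⟩
        have hN : N + n = j + n * c := by omega
        have := congrArg (· % n) hN
        simpa [Nat.mod_eq_of_lt hj] using this.symm
      · intro h
        refine ⟨N / n + 1, ?_⟩
        have := Nat.div_add_mod N n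
        rw [mul_add]
        simp only at h
        omega
    rw [e, if_congr hd rfl rfl]
  · rw [weylLevel_zero p]
    congr 1
    funext i
    exact (Nat.div_eq_of_lt (by omega)).symm
  · obtain ⟨s, hs⟩ := exists_mem_weylLevel (p := p) g
    refine ⟨n * s, weylLevel_mono (fun i => ?_) hs⟩
    simp only [v]
    rw [Nat.mul_add_div hn]
    exact Nat.le_add_right _ _

/-- The subalgebra generated by the `x_i` and the derivations `∂_i` with `i < j`. -/
noncomputable def partialWeyl (k : Type*) [Field k] (n j : ℕ) :
    Subalgebra k (Module.End k (MvPolynomial (Fin n) k)) :=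
  Algebra.adjoin k ((Set.range fun i => Algebra.lmul k (MvPolynomial (Fin n) k) (X i)) ∪
    {f | ∃ i : Fin n, (i : ℕ) < j ∧ f = dividedPower k n i 1})

lemma partialWeyl_mono {j j' : ℕ} (h : j ≤ j') : partialWeyl k n j ≤ partialWeyl k n j' :=
  Algebra.adjoin_mono (Set.union_subset_union_right _ fun _ ⟨i, hi, hf⟩ => ⟨i, hi.trans_le h, hf⟩)

lemma partialWeyl_zero : partialWeyl k n 0 = (Algebra.lmul k (MvPolynomial (Fin n) k)).range := by
  rw [← Algebra.map_top, ← adjoin_range_X, AlgHom.map_adjoin, ← Set.range_comp, partialWeyl]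
  congr 1
  simp [Function.comp_def]

lemma dividedPower_one_mul_dividedPower (i : Fin n) (r : ℕ) :
    dividedPower k n i 1 * dividedPower k n i r =
      ((r + 1 : ℕ) : k) • dividedPower k n i (r + 1) := by
  refine end_ext fun m => ?_
  rw [Module.End.mul_apply, LinearMap.smul_apply, dividedPower_monomial, map_smul,
    dividedPower_monomial, dividedPower_monomial, smul_smul, smul_smul, ← Nat.cast_mul,
    ← Nat.cast_mul, Nat.choose_one_right, Finsupp.tsub_apply, Finsupp.single_eq_same,
    ← Nat.choose_succ_right_eq, mul_comm (r + 1), tsub_tsub, ← Finsupp.single_add]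

lemma dividedPower_one_comm (i j : Fin n) :
    dividedPower k n i 1 * dividedPower k n j 1 = dividedPower k n j 1 * dividedPower k n i 1 := by
  by_cases hij : i = j
  · rw [hij]
  refine end_ext fun m => ?_
  simp only [Module.End.mul_apply, dividedPower_monomial, map_smul, smul_smul]
  rw [tsub_right_comm]
  congr 1
  simp [hij, Ne.symm hij, mul_comm]

lemma dividedPower_one_mul_X (i : Fin n) :
    dividedPower k n i 1 * Algebra.lmul k (MvPolynomial (Fin n) k) (X i) =
      Algebra.lmul k (MvPolynomial (Fin n) k) (X i) * dividedPower k n i 1 + 1 := by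
  refine end_ext fun m => ?_
  rw [← pow_one (X i), LinearMap.add_apply, Module.End.mul_apply, Module.End.mul_apply,
    dividedPower_monomial, map_smul, lmul_X_pow_monomial, lmul_X_pow_monomial,
    dividedPower_monomial, add_tsub_cancel_left, Module.End.one_apply]
  rcases Nat.eq_zero_or_pos (m i) with hm | hm
  · simp [hm]
  · rw [add_tsub_cancel_of_le (by simpa using Nat.one_le_of_lt hm)]
    simp [add_smul, add_comm]

lemma commutator_mem_partialWeyl {j : ℕ} (hj : j < n) {g : Module.End k (MvPolynomial (Fin n) k)}
    (hg : g ∈ partialWeyl k n j) :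
    dividedPower k n ⟨j, hj⟩ 1 * g - g * dividedPower k n ⟨j, hj⟩ 1 ∈ partialWeyl k n j := by
  induction hg using Algebra.adjoin_induction with
  | mem x hx =>
    rcases hx with ⟨i, rfl⟩ | ⟨i, -, rfl⟩
    · by_cases hij : i = ⟨j, hj⟩
      · subst hij
        simp only [dividedPower_one_mul_X, add_sub_cancel_left]
        exact one_mem _
      · have := dividedPower_comm_of_ne (k := k) hij 1 1
        rw [pow_one] at this
        simp only [this, sub_self]
        exact zero_mem _
    · rw [dividedPower_one_comm, sub_self]
      exact zero_mem _
  | algebraMap c =>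
    rw [Algebra.commutes, sub_self]
    exact zero_mem _
  | add x y _ _ hx hy =>
    convert add_mem hx hy using 1
    noncomm_ring
  | mul x y hx' hy' hx hy =>
    convert add_mem (mul_mem hx hy') (mul_mem hx' hy) using 1
    simp only [sub_mul, mul_sub, mul_assoc, sub_add_sub_cancel]

lemma isNoetherianRing_partialWeyl {j : ℕ} (hj : j ≤ n) :
    IsNoetherianRing (partialWeyl k n j) ∧ IsNoetherianRing (partialWeyl k n j)ᵐᵒᵖ := by
  induction j with
  | zero =>
    let φ := (Algebra.lmul k (MvPolynomial (Fin n) k)).rangeRestrict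
    have hφ : Function.Surjective φ := AlgHom.rangeRestrict_surjective _
    rw [partialWeyl_zero]
    exact ⟨isNoetherianRing_of_surjective _ _ φ.toRingHom hφ,
      isNoetherianRing_of_surjective _ _
        (φ.toRingHom.toOpposite fun a b => (Commute.all a b).map φ.toRingHom)
        (MulOpposite.op_surjective.comp hφ)⟩
  | succ j ih =>
    refine isNoetherianRing_of_eq_adjoin (y := dividedPower k n ⟨j, hj⟩ 1) rfl
      (partialWeyl_mono (Nat.le_succ j))
      (Algebra.subset_adjoin (Or.inr ⟨⟨j, hj⟩, Nat.lt_succ_self j, rfl⟩)) ?_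
      (fun g hg => commutator_mem_partialWeyl hj hg) (ih (Nat.le_of_succ_le hj))
    rintro x (⟨i, rfl⟩ | ⟨i, hi, rfl⟩)
    · exact Or.inl (Algebra.subset_adjoin (Or.inl ⟨i, rfl⟩))
    · rcases Nat.lt_succ_iff_lt_or_eq.1 hi with hi | hi
      · exact Or.inl (Algebra.subset_adjoin (Or.inr ⟨i, hi, rfl⟩))
      · obtain rfl : i = ⟨j, hj⟩ := Fin.ext hi
        exact Or.inr rfl

lemma weylAlgebra_eq_partialWeyl [CharZero k] : weylAlgebra k n = partialWeyl k n n := by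
  refine le_antisymm (Algebra.adjoin_le ?_) (Algebra.adjoin_le ?_)
  · rintro _ (⟨i, rfl⟩ | ⟨i, r, -, rfl⟩)
    · exact Algebra.subset_adjoin (Or.inl ⟨i, rfl⟩)
    · induction r with
      | zero =>
        rw [dividedPower_zero]
        exact one_mem _
      | succ r ih =>
        have hr : ((r + 1 : ℕ) : k) ≠ 0 := Nat.cast_ne_zero.2 r.succ_ne_zero
        rw [← inv_smul_smul₀ hr (dividedPower k n i (r + 1)),
          ← dividedPower_one_mul_dividedPower]
        have hi : dividedPower k n i 1 ∈ partialWeyl k n n :=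
          Algebra.subset_adjoin (Or.inr ⟨i, i.2, rfl⟩)
        exact Subalgebra.smul_mem _ (mul_mem hi ih) _
  · rintro _ (⟨i, rfl⟩ | ⟨i, -, rfl⟩)
    · exact lmul_mem_weylAlgebra _
    · exact dividedPower_mem_weylAlgebra _ _

theorem weylAlgebra_coherent_of_charZero [CharZero k] :
    IsLeftCoherent (weylAlgebra k n) ∧ IsRightCoherent (weylAlgebra k n) := by
  rw [weylAlgebra_eq_partialWeyl]
  obtain ⟨h1, h2⟩ := isNoetherianRing_partialWeyl (k := k) (le_refl n)
  exact coherent_of_isNoetherianRing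

end Weyl

/-- The Weyl algebra `A_n(k)` over any field `k` is a coherent ring
(both left and right coherent). -/
theorem weylAlgebra_coherent (k : Type*) [Field k] (n : ℕ) (hn : 1 ≤ n) :
    IsLeftCoherent (weylAlgebra k n) ∧ IsRightCoherent (weylAlgebra k n) := by
  rcases CharP.exists' k with h | ⟨p, hp, hk⟩
  · exact weylAlgebra_coherent_of_charZero
  · exact weylAlgebra_coherent_of_charP p hn
end

section
/- Let k be a field of characteristic p > 0, n ≥ 1, and A = k[x_1,…,x_n]. For all integers 0 ≤ s ≤ r, the ring D_r = End_{A_r}(A) is flat both as a left module and as a right module over its subring D_s = End_{A_s}(A), where A_r = k[x_1^{p^r},…,x_n^{p^r}] and the module structures come from the inclusion D_s ⊆ D_r inside End_k(A). -/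
/-- Flatness of a (left) module over a possibly noncommutative ring, via the standard
equational criterion (Lazard/Villamayor): every finite relation `∑ rᵢ • xᵢ = 0` is trivial.
Over a commutative ring this is equivalent to `Module.Flat`; applying it to `Rᵐᵒᵖ`-modules
gives flatness of right modules. -/
def IsFlatModule (R : Type*) [Ring R] (M : Type*) [AddCommGroup M] [Module R M] : Prop :=
  ∀ (m : ℕ) (x : Fin m → M) (r : Fin m → R), (∑ i, r i • x i) = 0 →
    ∃ (l : ℕ) (y : Fin l → M) (a : Fin m → Fin l → R),
      (∀ i, x i = ∑ j, a i j • y j) ∧ ∀ j, (∑ i, r i * a i j) = 0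

open MvPolynomial in
theorem mem_endAr_iff {k : Type*} [Field k] {n p r : ℕ}
    {φ : Module.End k (MvPolynomial (Fin n) k)} :
    φ ∈ endAr k n p r ↔ ∀ (m : Fin n →₀ ℕ) (f : MvPolynomial (Fin n) k),
      φ (monomial (p ^ r • m) 1 * f) = monomial (p ^ r • m) 1 * φ f := by
  rw [endAr, Subring.mem_centralizer_iff]
  constructor
  · intro h m f
    have hm : (monomial (p ^ r • m) (1 : k)) ∈ subAr k n p r := by
      rw [monomial_eq, C_1, one_mul, Finsupp.prod_fintype _ _ (fun _ => pow_zero _)]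
      refine Subalgebra.prod_mem _ fun i _ => ?_
      rw [Finsupp.smul_apply, smul_eq_mul, pow_mul]
      exact Subalgebra.pow_mem _ (Algebra.subset_adjoin (Set.mem_range_self i)) _
    exact (LinearMap.congr_fun (h _ ⟨_, hm, rfl⟩) f).symm
  · rintro h _ ⟨b, hb, rfl⟩
    have hcomm : ∀ f, φ (b * f) = b * φ f := by
      refine Algebra.adjoin_induction (p := fun b _ => ∀ f, φ (b * f) = b * φ f)
        ?_ ?_ ?_ ?_ hb
      · rintro _ ⟨i, rfl⟩ f
        have := h (Finsupp.single i 1) f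
        rwa [Finsupp.smul_single, smul_eq_mul, mul_one, ← X_pow_eq_monomial] at this
      · intro c f
        rw [← Algebra.smul_def, ← Algebra.smul_def, map_smul]
      · intro x y _ _ hx hy f
        rw [add_mul, add_mul, map_add, hx, hy]
      · intro x y _ _ hx hy f
        rw [mul_assoc, mul_assoc, hx, hy]
    exact LinearMap.ext fun f => (hcomm f).symm

/-- The coefficient of `x^v` with respect to the basis of the monomials with exponents `< q` of
`k[x_1,…,x_n]` over `k[x_1^q,…,x_n^q]`. -/
noncomputable def residueCoeff (k : Type*) [Field k] {n : ℕ} (q : ℕ) (v : Fin n →₀ ℕ) :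
    Module.End k (MvPolynomial (Fin n) k) :=
  (MvPolynomial.basisMonomials (Fin n) k).constr k fun m =>
    if ∀ i, m i % q = v i then MvPolynomial.monomial (m - v) 1 else 0

/-- A tuple of residues regarded as an exponent vector. -/
noncomputable def residueExponent {n q : ℕ} (v : Fin n → Fin q) : Fin n →₀ ℕ :=
  Finsupp.equivFunOnFinite.symm fun i => (v i : ℕ)

@[simp]
theorem residueExponent_apply {n q : ℕ} (v : Fin n → Fin q) (i : Fin n) :
    residueExponent v i = v i := rfl

section ResidueCoeff

open MvPolynomial

variable {k : Type*} [Field k] {n : ℕ}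

theorem residueCoeff_monomial (q : ℕ) (v m : Fin n →₀ ℕ) :
    residueCoeff k q v (monomial m 1) =
      if ∀ i, m i % q = v i then monomial (m - v) 1 else 0 := by
  have h := (basisMonomials (Fin n) k).constr_basis k
    (fun m => if ∀ i, m i % q = v i then monomial (m - v) (1 : k) else 0) m
  rwa [coe_basisMonomials] at h

/-- Two linear maps on polynomials agree as soon as they agree on monomials. -/
theorem linearMap_ext_monomial {M : Type*} [AddCommMonoid M] [Module k M]
    {φ ψ : MvPolynomial (Fin n) k →ₗ[k] M}
    (h : ∀ m, φ (monomial m 1) = ψ (monomial m 1)) : φ = ψ :=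
  (basisMonomials (Fin n) k).ext fun m => by simpa using h m

theorem residueCoeff_monomial_smul_mul (q : ℕ) (v m : Fin n →₀ ℕ) (f : MvPolynomial (Fin n) k) :
    residueCoeff k q v (monomial (q • m) 1 * f) = monomial (q • m) 1 * residueCoeff k q v f := by
  suffices h : residueCoeff k q v ∘ₗ LinearMap.mulLeft k (monomial (q • m) 1) =
      LinearMap.mulLeft k (monomial (q • m) 1) ∘ₗ residueCoeff k q v from
    LinearMap.congr_fun h f
  refine linearMap_ext_monomial fun l => ?_
  simp only [LinearMap.comp_apply, LinearMap.mulLeft_apply, monomial_mul, one_mul,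
    residueCoeff_monomial, Finsupp.add_apply, Finsupp.smul_apply, smul_eq_mul,
    Nat.mul_add_mod]
  split_ifs with h
  · rw [monomial_mul, one_mul, add_tsub_assoc_of_le fun i => (h i) ▸ Nat.mod_le _ _]
  · rw [mul_zero]

theorem residueCoeff_mem_endAr (p r : ℕ) (v : Fin n →₀ ℕ) :
    residueCoeff k (p ^ r) v ∈ endAr k n p r :=
  mem_endAr_iff.2 fun m f => residueCoeff_monomial_smul_mul _ v m f

/-- The exponent of the monomial `residueCoeff q v (x^m)`, when nonzero, is divisible by `q`. -/
theorem exists_eq_smul_of_mod_eq {q : ℕ} {m v : Fin n →₀ ℕ} (h : ∀ i, m i % q = v i) :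
    ∃ l : Fin n →₀ ℕ, m - v = q • l := by
  refine ⟨Finsupp.equivFunOnFinite.symm fun i => m i / q, Finsupp.ext fun i => ?_⟩
  have := Nat.mod_add_div (m i) q
  simp only [Finsupp.tsub_apply, Finsupp.smul_apply, smul_eq_mul,
    Finsupp.equivFunOnFinite_symm_apply_apply, ← h i]
  omega

theorem map_residueCoeff_mul {p r : ℕ} {φ : Module.End k (MvPolynomial (Fin n) k)}
    (hφ : φ ∈ endAr k n p r) (v : Fin n →₀ ℕ) (x f : MvPolynomial (Fin n) k) :
    φ (residueCoeff k (p ^ r) v x * f) = residueCoeff k (p ^ r) v x * φ f := by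
  suffices h : φ ∘ₗ LinearMap.mulRight k f ∘ₗ residueCoeff k (p ^ r) v =
      LinearMap.mulRight k (φ f) ∘ₗ residueCoeff k (p ^ r) v from LinearMap.congr_fun h x
  refine linearMap_ext_monomial fun m => ?_
  simp only [LinearMap.comp_apply, LinearMap.mulRight_apply, residueCoeff_monomial]
  split_ifs with h
  · obtain ⟨l, hl⟩ := exists_eq_smul_of_mod_eq h
    rw [hl, mem_endAr_iff.1 hφ]
  · rw [zero_mul, zero_mul, map_zero]

theorem sum_residueCoeff_mul {q : ℕ} (hq : 0 < q) (x : MvPolynomial (Fin n) k) :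
    ∑ v : Fin n → Fin q, residueCoeff k q (residueExponent v) x *
      monomial (residueExponent v) 1 = x := by
  suffices h : ∑ v : Fin n → Fin q, LinearMap.mulRight k (monomial (residueExponent v) 1) ∘ₗ
      residueCoeff k q (residueExponent v) = LinearMap.id by
    simpa [LinearMap.sum_apply] using LinearMap.congr_fun h x
  refine linearMap_ext_monomial fun m => ?_
  rw [LinearMap.sum_apply,
    Finset.sum_eq_single (fun i => (⟨m i % q, Nat.mod_lt _ hq⟩ : Fin q))]
  · simp only [LinearMap.comp_apply, LinearMap.mulRight_apply, residueCoeff_monomial,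
      residueExponent_apply, implies_true, if_true, monomial_mul, one_mul, LinearMap.id_apply]
    rw [tsub_add_cancel_of_le]
    exact fun i => Nat.mod_le _ _
  · intro v _ hv
    rw [LinearMap.comp_apply, LinearMap.mulRight_apply, residueCoeff_monomial, if_neg, zero_mul]
    exact fun h => hv (funext fun i => Fin.ext (h i).symm)
  · exact fun h => (h (Finset.mem_univ _)).elim

theorem residueCoeff_zero_residueCoeff {q q' : ℕ} (hq : q ∣ q') (v : Fin n →₀ ℕ)
    (x : MvPolynomial (Fin n) k) :
    residueCoeff k q 0 (residueCoeff k q' v x) = residueCoeff k q' v x := by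
  suffices h : residueCoeff k q 0 ∘ₗ residueCoeff k q' v = residueCoeff k q' v from
    LinearMap.congr_fun h x
  refine linearMap_ext_monomial fun m => ?_
  rw [LinearMap.comp_apply, residueCoeff_monomial]
  split_ifs with h
  · obtain ⟨l, hl⟩ := exists_eq_smul_of_mod_eq h
    rw [hl, residueCoeff_monomial, if_pos, tsub_zero]
    intro i
    simpa using Nat.mod_eq_zero_of_dvd (hq.mul_right (l i))
  · exact map_zero _

/-- The monomials of exponent `q • (Q - 1 - j)` are dual to those of exponent `q • j` for the
trace form `residueCoeff (q * Q) (q • (Q - 1))`; this is the case of the pairing with `1`. -/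
theorem residueCoeff_top_monomial {q Q : ℕ} (hq : 0 < q) [NeZero Q] (j : Fin n → Fin Q) :
    residueCoeff k (q * Q) (q • residueExponent fun _ => Fin.rev (0 : Fin Q))
      (monomial (q • residueExponent fun i => (j i).rev) 1) = if j = 0 then 1 else 0 := by
  rw [residueCoeff_monomial]
  have hiff : (∀ i, (q • residueExponent fun i => (j i).rev) i % (q * Q) =
      (q • residueExponent fun _ => Fin.rev (0 : Fin Q)) i) ↔ j = 0 := by
    simp only [Finsupp.smul_apply, residueExponent_apply, smul_eq_mul, Nat.mul_mod_mul_left,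
      Nat.mod_eq_of_lt (Fin.is_lt _), Nat.mul_right_inj hq.ne', Fin.val_inj, Fin.rev_inj,
      funext_iff, Pi.zero_apply]
  simp only [hiff]
  split_ifs with h
  · subst h
    simp only [Pi.zero_apply, tsub_self]
    rfl
  · rfl

/-- The canonical lift of an operator linear over `k[x_1^{qQ},…,x_n^{qQ}]` to one linear over
`k[x_1^q,…,x_n^q]`, built from dual bases for the trace form. -/
noncomputable def traceLift (q Q : ℕ) (g : Module.End k (MvPolynomial (Fin n) k)) :
    Module.End k (MvPolynomial (Fin n) k) :=
  ∑ j : Fin n → Fin Q,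
    LinearMap.mulRight k (monomial (q • residueExponent fun i => (j i).rev) 1) ∘ₗ
      g ∘ₗ LinearMap.mulLeft k (monomial (q • residueExponent j) 1)

theorem traceLift_apply (q Q : ℕ) (g : Module.End k (MvPolynomial (Fin n) k))
    (x : MvPolynomial (Fin n) k) :
    traceLift q Q g x = ∑ j : Fin n → Fin Q, g (monomial (q • residueExponent j) 1 * x) *
      monomial (q • residueExponent fun i => (j i).rev) 1 := by
  simp [traceLift, LinearMap.sum_apply]

theorem traceLift_monomial_smul_mul (q Q : ℕ) [NeZero Q]
    {g : Module.End k (MvPolynomial (Fin n) k)}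
    (hg : ∀ m f, g (monomial ((q * Q) • m) 1 * f) = monomial ((q * Q) • m) 1 * g f)
    (m : Fin n →₀ ℕ) (x : MvPolynomial (Fin n) k) :
    traceLift q Q g (monomial (q • m) 1 * x) = monomial (q • m) 1 * traceLift q Q g x := by
  rw [traceLift_apply, traceLift_apply, Finset.mul_sum]
  refine Fintype.sum_equiv (Equiv.addRight fun i => (Fin.ofNat Q (m i))) _ _ fun j => ?_
  let c : Fin n →₀ ℕ := Finsupp.equivFunOnFinite.symm fun i => (j i + m i) / Q
  have hval : ∀ i, ((j i + Fin.ofNat Q (m i) : Fin Q) : ℕ) + Q * c i = j i + m i := fun i => by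
    rw [Fin.val_add, Fin.val_ofNat, Nat.add_mod_mod]
    exact Nat.mod_add_div _ _
  have h₁ : q • residueExponent j + q • m = (q * Q) • c +
      q • residueExponent (j + fun i => Fin.ofNat Q (m i)) := by
    ext i
    simp only [Finsupp.add_apply, Finsupp.smul_apply, residueExponent_apply, smul_eq_mul,
      Pi.add_apply, mul_assoc, ← mul_add, ← hval i, add_comm]
  have h₂ : (q * Q) • c + q • (residueExponent fun i => (j i).rev) =
      q • m + q • residueExponent fun i => (j i + Fin.ofNat Q (m i)).rev := by
    ext i
    simp only [Finsupp.add_apply, Finsupp.smul_apply, residueExponent_apply, smul_eq_mul,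
      mul_assoc, ← mul_add]
    congr 1
    have := hval i
    rw [Fin.val_rev, Fin.val_rev]
    generalize j i + Fin.ofNat Q (m i) = l at this ⊢
    generalize Q * c i = t at this ⊢
    have := l.is_lt
    have := (j i).is_lt
    omega
  simp only [Equiv.coe_addRight]
  rw [← mul_assoc, monomial_mul, one_mul, h₁, ← one_mul (1 : k), ← monomial_mul, mul_assoc, hg,
    mul_right_comm, monomial_mul, one_mul, h₂, ← one_mul (1 : k), ← monomial_mul]
  simp only [one_mul]
  rw [mul_assoc, mul_comm (monomial _ _) (g _)]
  rfl

theorem residueCoeff_top_traceLift {q Q : ℕ} (hq : 0 < q) [NeZero Q]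
    {p r : ℕ} (hr : p ^ r = q * Q) (v : Fin n →₀ ℕ)
    (φ : Module.End k (MvPolynomial (Fin n) k)) (x : MvPolynomial (Fin n) k) :
    residueCoeff k (q * Q) (q • residueExponent fun _ => Fin.rev (0 : Fin Q))
      (traceLift q Q (residueCoeff k (q * Q) v * φ) x) = residueCoeff k (q * Q) v (φ x) := by
  rw [traceLift_apply, map_sum, Finset.sum_eq_single 0]
  · rw [Module.End.mul_apply, ← hr, map_residueCoeff_mul (residueCoeff_mem_endAr p r _), hr]
    have := residueCoeff_top_monomial (k := k) hq (0 : Fin n → Fin Q)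
    rw [if_pos rfl] at this
    rw [this, mul_one]
    have h0 : residueExponent (0 : Fin n → Fin Q) = 0 := by ext; simp
    rw [h0, smul_zero]
    simp
  · intro j _ hj
    rw [Module.End.mul_apply, ← hr, map_residueCoeff_mul (residueCoeff_mem_endAr p r _), hr,
      residueCoeff_top_monomial hq, if_neg hj, mul_zero]
  · exact fun h => (h (Finset.mem_univ _)).elim

end ResidueCoeff

/-- A module with a finite dual basis is flat. -/
theorem isFlatModule_of_dualBasis {R M ι : Type*} [Ring R] [AddCommGroup M] [Module R M]
    [Fintype ι] (y : ι → M) (f : ι → M →ₗ[R] R) (h : ∀ x, ∑ j, f j x • y j = x) :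
    IsFlatModule R M := by
  intro m x r hx
  let e := (Fintype.equivFin ι).symm
  refine ⟨Fintype.card ι, y ∘ e, fun i j => f (e j) (x i), fun i => ?_, fun j => ?_⟩
  · exact ((e.sum_comp fun j => f j (x i) • y j).trans (h _)).symm
  · simpa [map_sum] using congrArg (f (e j)) hx

/-- For `s ≤ r`, the ring `D_r = End_{A_r}(A)` is flat both as a left module and as a right
module over its subring `D_s = End_{A_s}(A)`, the module structures coming from the inclusion
`D_s ⊆ D_r` inside `End_k(A)`. (Right flatness is expressed as flatness of `D_rᵐᵒᵖ` as a
left `D_sᵐᵒᵖ`-module.) -/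
theorem endAr_flat_left_right (k : Type*) [Field k] (p : ℕ) (hp : 0 < p) [CharP k p]
    (n : ℕ) (hn : 1 ≤ n) (s r : ℕ) (hsr : s ≤ r)
    (hle : endAr k n p s ≤ endAr k n p r) :
    (letI := (Subring.inclusion hle).toModule;
      IsFlatModule (endAr k n p s) (endAr k n p r)) ∧
    (letI := (RingHom.op (Subring.inclusion hle)).toModule;
      IsFlatModule (endAr k n p s)ᵐᵒᵖ (endAr k n p r)ᵐᵒᵖ) := by
  obtain ⟨d, rfl⟩ := Nat.exists_eq_add_of_le hsr
  have hs : 0 < p ^ s := pow_pos hp s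
  have hr : 0 < p ^ (s + d) := pow_pos hp _
  have : NeZero (p ^ d) := ⟨(pow_pos hp d).ne'⟩
  constructor
  · let _ := (Subring.inclusion hle).toModule
    refine isFlatModule_of_dualBasis (ι := Fin n → Fin (p ^ (s + d)))
      (fun v => ⟨residueCoeff k (p ^ (s + d)) (residueExponent v), residueCoeff_mem_endAr _ _ _⟩)
      (fun v =>
        { toFun := fun φ => ⟨LinearMap.mulRight k (φ.1 (MvPolynomial.monomial
              (residueExponent v) 1)) ∘ₗ residueCoeff k (p ^ s) 0,
            mem_endAr_iff.2 fun m f => by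
              simp [residueCoeff_monomial_smul_mul, mul_assoc]⟩
          map_add' := fun φ ψ => Subtype.ext <| LinearMap.ext fun x => by
            simp [mul_add]
          map_smul' := fun ψ φ => Subtype.ext <| LinearMap.ext fun x =>
            (map_residueCoeff_mul ψ.2 _ _ _).symm })
      fun φ => Subtype.ext <| LinearMap.ext fun x => ?_
    rw [AddSubmonoidClass.coe_finsetSum, LinearMap.sum_apply]
    conv_rhs => rw [← sum_residueCoeff_mul hr x, map_sum]
    refine Finset.sum_congr rfl fun v _ => ?_
    rw [map_residueCoeff_mul φ.2]
    exact congrArg (· * _) (residueCoeff_zero_residueCoeff (pow_dvd_pow p hsr) _ x)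
  · let _ := (RingHom.op (Subring.inclusion hle)).toModule
    have hpow : p ^ (s + d) = p ^ s * p ^ d := pow_add p s d
    refine isFlatModule_of_dualBasis (ι := Fin n → Fin (p ^ (s + d)))
      (fun v => MulOpposite.op ⟨LinearMap.mulRight k (MvPolynomial.monomial
          (residueExponent v) 1) ∘ₗ residueCoeff k (p ^ (s + d))
          (p ^ s • residueExponent fun _ => Fin.rev (0 : Fin (p ^ d))),
        mem_endAr_iff.2 fun m f => by simp [residueCoeff_monomial_smul_mul, mul_assoc]⟩)
      (fun v =>
        { toFun := fun φ => MulOpposite.op ⟨traceLift (p ^ s) (p ^ d)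
              (residueCoeff k (p ^ (s + d)) (residueExponent v) * φ.unop.1),
            mem_endAr_iff.2 <| traceLift_monomial_smul_mul _ _ <| by
              rw [← hpow]
              exact mem_endAr_iff.1 (mul_mem (residueCoeff_mem_endAr _ _ _) φ.unop.2)⟩
          map_add' := fun φ ψ => MulOpposite.unop_injective <| Subtype.ext <|
            LinearMap.ext fun x => by
              simp [traceLift_apply, add_mul, Finset.sum_add_distrib]
          map_smul' := fun ψ φ => MulOpposite.unop_injective <| Subtype.ext <|
            LinearMap.ext fun x => ?_ })
      fun φ => MulOpposite.unop_injective <| Subtype.ext <| LinearMap.ext fun x => ?_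
    · change traceLift _ _ (_ * (φ.unop.1 * ψ.unop.1)) x = traceLift _ _ _ (ψ.unop.1 x)
      simp only [traceLift_apply, Module.End.mul_apply, mem_endAr_iff.1 ψ.unop.2]
    · rw [Finset.unop_sum, AddSubmonoidClass.coe_finsetSum, LinearMap.sum_apply]
      conv_rhs => rw [← sum_residueCoeff_mul hr (φ.unop.1 x)]
      refine Finset.sum_congr rfl fun v _ => ?_
      have := residueCoeff_top_traceLift hs hpow (residueExponent v) φ.unop.1 x
      rw [← hpow] at this
      exact congrArg (· * MvPolynomial.monomial (residueExponent v) 1) this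
end
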